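/- Let V₁ and V₂ be varieties of L-structures such that the variety V₁ ∨ V₂ is congruence-distributive, and suppose that V₁ and V₂ have the amalgamation property and the congruence extension property, that (V₁)_FSI and (V₂)_FSI are closed under substructures, and that whenever A ∈ (V₁)_FSI ∩ (V₂)_FSI is a substructure of some B ∈ (V₁)_FSI ∪ (V₂)_FSI, A is a retract of B. Then V₁ ∨ V₂ has the amalgamation property. -/

import Mathlib

open FirstOrder Language Set

universe u

namespace Transfer

variable (L : FirstOrder.Language.{u, u})

/-- A bundled `L`-structure with carrier in universe `u`. -/
structure Struc : Type (u + 1) where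
  Carrier : Type u
  [str : L.Structure Carrier]

attribute [instance] Struc.str

/-- Product structure on a Pi type. -/
instance piStructure {ι : Type u} (M : ι → Type u) [∀ i, L.Structure (M i)] :
    L.Structure (∀ i, M i) where
  funMap f x i := Structure.funMap f fun j => x j i
  RelMap r x := ∀ i, Structure.RelMap r fun j => x j i

/-- Product structure on a binary product. -/
instance prodStructure (M N : Type u) [L.Structure M] [L.Structure N] :
    L.Structure (M × N) where
  funMap f x := (Structure.funMap f fun j => (x j).1, Structure.funMap f fun j => (x j).2)
  RelMap r x := Structure.RelMap r (fun j => (x j).1) ∧ Structure.RelMap r (fun j => (x j).2)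

variable {L}

/-- The bundled structure on a substructure. -/
abbrev ofSub (B : Struc L) (S : L.Substructure B.Carrier) : Struc L := ⟨S⟩

/-- The kernel of a map, as a set of pairs. -/
def kerSet {α β : Type u} (f : α → β) : Set (α × α) := {p | f p.1 = f p.2}

/-- The restriction of a binary relation on `B` to a substructure `S`. -/
def restrict {B : Struc L} (S : L.Substructure B.Carrier)
    (Θ : Set (B.Carrier × B.Carrier)) : Set ((ofSub B S).Carrier × (ofSub B S).Carrier) :=
  {p | ((p.1 : B.Carrier), (p.2 : B.Carrier)) ∈ Θ}

/-- The image of a binary relation on a substructure `S` in `B`. -/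
def lift {B : Struc L} (S : L.Substructure B.Carrier)
    (Θ : Set ((ofSub B S).Carrier × (ofSub B S).Carrier)) : Set (B.Carrier × B.Carrier) :=
  (fun p => ((p.1 : B.Carrier), (p.2 : B.Carrier))) '' Θ

/-- The set of `Q`-congruences of `A`: kernels of homomorphisms into members of `Q`. -/
def ConQ (Q : Set (Struc L)) (A : Struc L) : Set (Set (A.Carrier × A.Carrier)) :=
  {θ | ∃ M ∈ Q, ∃ f : A.Carrier →[L] M.Carrier, θ = kerSet f}

/-- The least `Q`-congruence of `A` containing `R`. -/
def cgQ (Q : Set (Struc L)) (A : Struc L) (R : Set (A.Carrier × A.Carrier)) :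
    Set (A.Carrier × A.Carrier) :=
  ⋂₀ {θ | θ ∈ ConQ Q A ∧ R ⊆ θ}

/-- The join of two `Q`-congruences in `Con_Q A`. -/
def joinQ (Q : Set (Struc L)) (A : Struc L) (θ φ : Set (A.Carrier × A.Carrier)) :
    Set (A.Carrier × A.Carrier) :=
  cgQ Q A (θ ∪ φ)

/-- `θ` is a meet-irreducible element of `Con_Q A`. -/
def MeetIrred (Q : Set (Struc L)) (A : Struc L) (θ : Set (A.Carrier × A.Carrier)) : Prop :=
  θ ∈ ConQ Q A ∧
    ∀ θ₁ ∈ ConQ Q A, ∀ θ₂ ∈ ConQ Q A, θ = θ₁ ∩ θ₂ → θ = θ₁ ∨ θ = θ₂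

/-- `θ` is a completely meet-irreducible element of `Con_Q A`. -/
def CompletelyMeetIrred (Q : Set (Struc L)) (A : Struc L)
    (θ : Set (A.Carrier × A.Carrier)) : Prop :=
  θ ∈ ConQ Q A ∧
    ∀ S ⊆ ConQ Q A, θ = ⋂₀ S → θ ∈ S

/-- The class of relatively finitely subdirectly irreducible members of `Q`. -/
def RFSI (Q : Set (Struc L)) : Set (Struc L) :=
  {A | A ∈ Q ∧ MeetIrred Q A (Set.diagonal A.Carrier)}

/-- The class of relatively subdirectly irreducible members of `Q`. -/
def RSI (Q : Set (Struc L)) : Set (Struc L) :=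
  {A | A ∈ Q ∧ CompletelyMeetIrred Q A (Set.diagonal A.Carrier)}

/-- `B` has the `Q`-congruence extension property. -/
def HasQCEP (Q : Set (Struc L)) (B : Struc L) : Prop :=
  ∀ S : L.Substructure B.Carrier, ∀ θ ∈ ConQ Q (ofSub B S),
    ∃ Φ ∈ ConQ Q B, restrict S Φ = θ

/-- A class `K` of members of `Q` has the `Q`-congruence extension property. -/
def ClassQCEP (Q K : Set (Struc L)) : Prop :=
  ∀ B ∈ K, HasQCEP Q B

variable (L)

/-- `Q` is a quasivariety: closed under isomorphisms, substructures, direct products,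
and ultraproducts. -/
def IsQuasivariety (Q : Set (Struc L)) : Prop :=
  (∀ A ∈ Q, ∀ B : Struc L, Nonempty (A.Carrier ≃[L] B.Carrier) → B ∈ Q) ∧
  (∀ B ∈ Q, ∀ S : L.Substructure B.Carrier, ofSub B S ∈ Q) ∧
  (∀ (ι : Type u) (f : ι → Struc L), (∀ i, f i ∈ Q) →
    (⟨∀ i, (f i).Carrier⟩ : Struc L) ∈ Q) ∧
  (∀ (ι : Type u) (f : ι → Struc L) (U : Ultrafilter ι), (∀ i, f i ∈ Q) →
    (⟨(U : Filter ι).Product fun i => (f i).Carrier⟩ : Struc L) ∈ Q)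

/-- `V` is a variety: closed under homomorphic images, substructures, and direct products. -/
def IsVariety (V : Set (Struc L)) : Prop :=
  (∀ A ∈ V, ∀ B : Struc L, ∀ f : A.Carrier →[L] B.Carrier, Function.Surjective f → B ∈ V) ∧
  (∀ B ∈ V, ∀ S : L.Substructure B.Carrier, ofSub B S ∈ V) ∧
  (∀ (ι : Type u) (f : ι → Struc L), (∀ i, f i ∈ V) →
    (⟨∀ i, (f i).Carrier⟩ : Struc L) ∈ V)

variable {L}

/-- `Q` is relatively congruence-distributive: `Con_Q A` is a distributive lattice
for every `A ∈ Q`. -/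
def RelCongDist (Q : Set (Struc L)) : Prop :=
  ∀ A ∈ Q, ∀ θ ∈ ConQ Q A, ∀ φ ∈ ConQ Q A, ∀ ψ ∈ ConQ Q A,
    θ ∩ joinQ Q A φ ψ = joinQ Q A (θ ∩ φ) (θ ∩ ψ)

/-- Relation composition `Θ ∘ Φ = {(a,c) : ∃ b, (a,b) ∈ Φ ∧ (b,c) ∈ Θ}`. -/
def relComp {α : Type u} (Θ Φ : Set (α × α)) : Set (α × α) :=
  {p | ∃ b, (p.1, b) ∈ Φ ∧ (b, p.2) ∈ Θ}

/-- `Q` is relatively congruence-permutable. -/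
def RelCongPerm (Q : Set (Struc L)) : Prop :=
  ∀ A ∈ Q, ∀ θ ∈ ConQ Q A, ∀ φ ∈ ConQ Q A, relComp θ φ = relComp φ θ

/-- A class `K` is closed under substructures. -/
def SubClosed (K : Set (Struc L)) : Prop :=
  ∀ B ∈ K, ∀ S : L.Substructure B.Carrier, ofSub B S ∈ K

/-- A class `K` is closed under isomorphisms. -/
def IsoClosed (K : Set (Struc L)) : Prop :=
  ∀ A ∈ K, ∀ B : Struc L, Nonempty (A.Carrier ≃[L] B.Carrier) → B ∈ K

/-- A universal class: closed under isomorphisms, substructures, and ultraproducts. -/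
def IsUniversalClass (K : Set (Struc L)) : Prop :=
  IsoClosed K ∧ SubClosed K ∧
  (∀ (ι : Type u) (f : ι → Struc L) (U : Ultrafilter ι), (∀ i, f i ∈ K) →
    (⟨(U : Filter ι).Product fun i => (f i).Carrier⟩ : Struc L) ∈ K)

/-- The extension property for a class `K`. -/
def HasEP (K : Set (Struc L)) : Prop :=
  ∀ A ∈ K, ∀ B ∈ K, ∀ C ∈ K,
    ∀ (φB : A.Carrier →[L] B.Carrier) (φC : A.Carrier →[L] C.Carrier),
      Function.Injective φB → Function.Surjective φC →
      ∃ D ∈ K, ∃ (ψB : B.Carrier →[L] D.Carrier) (ψC : C.Carrier →[L] D.Carrier),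
        Function.Injective ψC ∧ ∀ a, ψB (φB a) = ψC (φC a)

/-- The one-sided amalgamation property for a class `K`. -/
def Has1AP (K : Set (Struc L)) : Prop :=
  ∀ A ∈ K, ∀ B ∈ K, ∀ C ∈ K,
    ∀ (φB : A.Carrier →[L] B.Carrier) (φC : A.Carrier →[L] C.Carrier),
      Function.Injective φB → Function.Injective φC →
      ∃ D ∈ K, ∃ (ψB : B.Carrier →[L] D.Carrier) (ψC : C.Carrier →[L] D.Carrier),
        Function.Injective ψC ∧ ∀ a, ψB (φB a) = ψC (φC a)

/-- Every doubly injective span in `K` has an amalgam in `K'`. -/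
def HasAmalgamIn (K K' : Set (Struc L)) : Prop :=
  ∀ A ∈ K, ∀ B ∈ K, ∀ C ∈ K,
    ∀ (φB : A.Carrier →[L] B.Carrier) (φC : A.Carrier →[L] C.Carrier),
      Function.Injective φB → Function.Injective φC →
      ∃ D ∈ K', ∃ (ψB : B.Carrier →[L] D.Carrier) (ψC : C.Carrier →[L] D.Carrier),
        Function.Injective ψB ∧ Function.Injective ψC ∧ ∀ a, ψB (φB a) = ψC (φC a)

/-- The amalgamation property for a class `K`. -/
def HasAP (K : Set (Struc L)) : Prop := HasAmalgamIn K K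

/-- The transferable injections property for a class `K`. -/
def HasTIP (K : Set (Struc L)) : Prop :=
  ∀ A ∈ K, ∀ B ∈ K, ∀ C ∈ K,
    ∀ (φB : A.Carrier →[L] B.Carrier) (φC : A.Carrier →[L] C.Carrier),
      Function.Injective φB →
      ∃ D ∈ K, ∃ (ψB : B.Carrier →[L] D.Carrier) (ψC : C.Carrier →[L] D.Carrier),
        Function.Injective ψC ∧ ∀ a, ψB (φB a) = ψC (φC a)

/-- Every doubly injective span in `K` has a strong amalgam in `K'`. -/
def HasStrongAmalgamIn (K K' : Set (Struc L)) : Prop :=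
  ∀ A ∈ K, ∀ B ∈ K, ∀ C ∈ K,
    ∀ (φB : A.Carrier →[L] B.Carrier) (φC : A.Carrier →[L] C.Carrier),
      Function.Injective φB → Function.Injective φC →
      ∃ D ∈ K', ∃ (ψB : B.Carrier →[L] D.Carrier) (ψC : C.Carrier →[L] D.Carrier),
        Function.Injective ψB ∧ Function.Injective ψC ∧ (∀ a, ψB (φB a) = ψC (φC a)) ∧
        Set.range (fun a => ψB (φB a)) = Set.range ψB ∩ Set.range ψC

/-- The strong amalgamation property for a class `K`. -/
def HasSAP (K : Set (Struc L)) : Prop := HasStrongAmalgamIn K K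

/-- `φ : A → B` is an epimorphism in the class `K`. -/
def IsEpiIn (K : Set (Struc L)) {A B : Struc L} (φ : A.Carrier →[L] B.Carrier) : Prop :=
  ∀ C ∈ K, ∀ ψ₁ ψ₂ : B.Carrier →[L] C.Carrier,
    ψ₁.comp φ = ψ₂.comp φ → ψ₁ = ψ₂

/-- The class `K` has surjective epimorphisms. -/
def HasSE (K : Set (Struc L)) : Prop :=
  ∀ A ∈ K, ∀ B ∈ K, ∀ φ : A.Carrier →[L] B.Carrier,
    IsEpiIn K φ → Function.Surjective φ

/-- A substructure `S` of `B` is a retract of `B`. -/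
def IsRetract (B : Struc L) (S : L.Substructure B.Carrier) : Prop :=
  ∃ ψ : B.Carrier →[L] (ofSub B S).Carrier, ∀ a : (ofSub B S).Carrier, ψ (a : B.Carrier) = a


/-- The smallest variety containing `V₁ ∪ V₂`. -/
def varJoin (L : FirstOrder.Language.{u, u}) (V₁ V₂ : Set (Struc L)) : Set (Struc L) :=
  ⋂₀ {W | IsVariety L W ∧ V₁ ⊆ W ∧ V₂ ⊆ W}

section Homs

variable {L : FirstOrder.Language.{u, u}}

/-- A map commuting with the operations of an algebraic language is a homomorphism. -/
def homOfMapFun [L.IsAlgebraic] {M N : Type u} [L.Structure M] [L.Structure N] (f : M → N)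
    (hf : ∀ (n : ℕ) (g : L.Functions n) (x : Fin n → M),
      f (Structure.funMap g x) = Structure.funMap g fun i => f (x i)) : M →[L] N where
  toFun := f
  map_fun' g x := hf _ g x
  map_rel' r _ _ := isEmptyElim r

theorem hom_map_fun {M N : Type u} [L.Structure M] [L.Structure N] (f : M →[L] N) {n : ℕ}
    (g : L.Functions n) (x : Fin n → M) :
    f (Structure.funMap g x) = Structure.funMap g fun i => f (x i) :=
  f.map_fun g x

/-- A homomorphism, viewed as a map onto its range. -/
def rangeMap {M N : Type u} [L.Structure M] [L.Structure N] (f : M →[L] N) : M →[L] f.range :=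
  f.codRestrict f.range f.mem_range_self

theorem coe_rangeMap {M N : Type u} [L.Structure M] [L.Structure N] (f : M →[L] N) (a : M) :
    (rangeMap f a : N) = f a :=
  rfl

theorem rangeMap_surjective {M N : Type u} [L.Structure M] [L.Structure N] (f : M →[L] N) :
    Function.Surjective (rangeMap f) := by
  rintro ⟨_, a, rfl⟩
  exact ⟨a, rfl⟩

theorem rangeMap_eq_iff {M N : Type u} [L.Structure M] [L.Structure N] (f : M →[L] N) (a b : M) :
    rangeMap f a = rangeMap f b ↔ f a = f b :=
  Subtype.ext_iff

theorem kerSet_rangeMap {M N : Type u} [L.Structure M] [L.Structure N] (f : M →[L] N) :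
    kerSet (rangeMap f) = kerSet f :=
  Set.ext fun p => rangeMap_eq_iff f p.1 p.2

/-- A homomorphism factors through a surjective homomorphism with smaller kernel. -/
theorem exists_factor [L.IsAlgebraic] {A M N : Type u} [L.Structure A] [L.Structure M]
    [L.Structure N] (f : A →[L] M) (g : A →[L] N) (hf : Function.Surjective f)
    (hfg : ∀ a b, f a = f b → g a = g b) : ∃ h : M →[L] N, ∀ a, h (f a) = g a := by
  choose s hs using hf
  have key : ∀ a, g (s (f a)) = g a := fun a => hfg _ _ (hs _)
  refine ⟨homOfMapFun (fun m => g (s m)) fun n F x => ?_, key⟩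
  have h1 : Structure.funMap F x = f (Structure.funMap F fun i => s (x i)) := by
    rw [hom_map_fun]; simp only [hs]
  rw [h1, key, hom_map_fun]

/-- The projection from a product of structures. -/
def projHom {ι : Type u} (M : ι → Type u) [∀ i, L.Structure (M i)] (i : ι) :
    (∀ i, M i) →[L] M i where
  toFun x := x i
  map_fun' _ _ := rfl
  map_rel' _ _ h := h i

/-- The homomorphism into a product given by a family of homomorphisms. -/
def piHom {ι : Type u} (M : ι → Type u) [∀ i, L.Structure (M i)] {A : Type u} [L.Structure A]
    (f : ∀ i, A →[L] M i) : A →[L] (∀ i, M i) where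
  toFun a i := f i a
  map_fun' g x := funext fun i => (f i).map_fun g x
  map_rel' r x h := fun i => (f i).map_rel r x h

end Homs

section Congruences

variable {L : FirstOrder.Language.{u, u}}

/-- An equivalence relation compatible with the operations. -/
structure IsCong (L : FirstOrder.Language.{u, u}) {A : Type u} [L.Structure A]
    (θ : Set (A × A)) : Prop where
  refl : ∀ a, (a, a) ∈ θ
  symm : ∀ {a b}, (a, b) ∈ θ → (b, a) ∈ θ
  trans : ∀ {a b c}, (a, b) ∈ θ → (b, c) ∈ θ → (a, c) ∈ θ
  compat : ∀ {n : ℕ} (f : L.Functions n) {x y : Fin n → A}, (∀ i, (x i, y i) ∈ θ) →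
    (Structure.funMap f x, Structure.funMap f y) ∈ θ

/-- The inverse image of a binary relation under a map. -/
def pullback {A B : Type u} (f : A → B) (θ : Set (B × B)) : Set (A × A) :=
  {p | (f p.1, f p.2) ∈ θ}

/-- The image of a binary relation under a map. -/
def pushforward {A B : Type u} (f : A → B) (θ : Set (A × A)) : Set (B × B) :=
  {p | ∃ a b, (a, b) ∈ θ ∧ f a = p.1 ∧ f b = p.2}

theorem isCong_kerSet {A B : Type u} [L.Structure A] [L.Structure B] (f : A →[L] B) :
    IsCong L (kerSet f) where
  refl _ := rfl
  symm h := Eq.symm h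
  trans h h' := Eq.trans h h'
  compat g x y h := by
    change f _ = f _
    rw [hom_map_fun, hom_map_fun]
    exact congrArg _ (funext h)

theorem isCong_diagonal (A : Type u) [L.Structure A] : IsCong L (Set.diagonal A) :=
  isCong_kerSet (Hom.id L A)

theorem IsCong.diagonal_subset {A : Type u} [L.Structure A] {θ : Set (A × A)} (h : IsCong L θ) :
    Set.diagonal A ⊆ θ := by
  rintro ⟨a, b⟩ (rfl : a = b)
  exact h.refl a

theorem IsCong.sInter {A : Type u} [L.Structure A] {S : Set (Set (A × A))}
    (h : ∀ θ ∈ S, IsCong L θ) : IsCong L (⋂₀ S) where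
  refl a θ hθ := (h θ hθ).refl a
  symm hab θ hθ := (h θ hθ).symm (hab θ hθ)
  trans hab hbc θ hθ := (h θ hθ).trans (hab θ hθ) (hbc θ hθ)
  compat f _ _ hxy θ hθ := (h θ hθ).compat f fun i => hxy i θ hθ

theorem IsCong.inter {A : Type u} [L.Structure A] {θ φ : Set (A × A)}
    (hθ : IsCong L θ) (hφ : IsCong L φ) : IsCong L (θ ∩ φ) where
  refl a := ⟨hθ.refl a, hφ.refl a⟩
  symm h := ⟨hθ.symm h.1, hφ.symm h.2⟩
  trans h h' := ⟨hθ.trans h.1 h'.1, hφ.trans h.2 h'.2⟩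
  compat f _ _ h := ⟨hθ.compat f fun i => (h i).1, hφ.compat f fun i => (h i).2⟩

theorem IsCong.pullback {A B : Type u} [L.Structure A] [L.Structure B] {θ : Set (B × B)}
    (h : IsCong L θ) (f : A →[L] B) : IsCong L (pullback f θ) where
  refl a := h.refl (f a)
  symm hab := h.symm hab
  trans hab hbc := h.trans hab hbc
  compat g x y hxy := by
    change (f _, f _) ∈ θ
    rw [hom_map_fun, hom_map_fun]
    exact h.compat g hxy

theorem pullback_pushforward {A B : Type u} [L.Structure A] [L.Structure B] {θ : Set (A × A)}
    (h : IsCong L θ) (f : A →[L] B) (hk : kerSet f ⊆ θ) :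
    pullback f (pushforward f θ) = θ := by
  ext ⟨a, b⟩
  constructor
  · rintro ⟨a', b', hab, ha, hb⟩
    exact h.trans (h.trans (hk (show f a = f a' from ha.symm)) hab) (hk hb)
  · intro hab
    exact ⟨a, b, hab, rfl, rfl⟩

theorem IsCong.pushforward {A B : Type u} [L.Structure A] [L.Structure B] {θ : Set (A × A)}
    (h : IsCong L θ) (f : A →[L] B) (hf : Function.Surjective f) (hk : kerSet f ⊆ θ) :
    IsCong L (pushforward f θ) where
  refl b := by
    obtain ⟨a, rfl⟩ := hf b
    exact ⟨a, a, h.refl a, rfl, rfl⟩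
  symm := by
    rintro _ _ ⟨a, b, hab, rfl, rfl⟩
    exact ⟨b, a, h.symm hab, rfl, rfl⟩
  trans := by
    rintro _ _ _ ⟨a, b, hab, rfl, rfl⟩ ⟨b', c, hbc, hb, rfl⟩
    exact ⟨a, c, h.trans hab (h.trans (hk (show f b = f b' from hb.symm)) hbc), rfl, rfl⟩
  compat g x y hxy := by
    choose a b hab ha hb using hxy
    refine ⟨_, _, h.compat g hab, ?_, ?_⟩
    · rw [hom_map_fun]; exact congrArg _ (funext ha)
    · rw [hom_map_fun]; exact congrArg _ (funext hb)

theorem IsCong.sUnion {A : Type u} [L.Structure A] {c : Set (Set (A × A))}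
    (h : ∀ θ ∈ c, IsCong L θ) (hc : IsChain (· ⊆ ·) c) (hne : c.Nonempty) :
    IsCong L (⋃₀ c) where
  refl a := by
    obtain ⟨θ, hθ⟩ := hne
    exact ⟨θ, hθ, (h θ hθ).refl a⟩
  symm := by
    rintro _ _ ⟨θ, hθ, hab⟩
    exact ⟨θ, hθ, (h θ hθ).symm hab⟩
  trans := by
    rintro _ _ _ ⟨θ, hθ, hab⟩ ⟨φ, hφ, hbc⟩
    rcases hc.total hθ hφ with hs | hs
    · exact ⟨φ, hφ, (h φ hφ).trans (hs hab) hbc⟩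
    · exact ⟨θ, hθ, (h θ hθ).trans hab (hs hbc)⟩
  compat f x y hxy := by
    obtain ⟨θ, hθ, hsub⟩ := hc.directedOn.exists_mem_subset_of_finite_of_subset_sUnion hne
      (Set.finite_range fun i => (x i, y i)) (Set.range_subset_iff.2 hxy)
    exact ⟨θ, hθ, (h θ hθ).compat f fun i => hsub ⟨i, rfl⟩⟩

/-- Among the congruences disjoint from a set of pairs, there is a maximal one. -/
theorem exists_maximal_cong {A : Type u} [L.Structure A] {N : Set (A × A)}
    (hN : Disjoint (Set.diagonal A) N) :
    ∃ Φ, IsCong L Φ ∧ Disjoint Φ N ∧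
      ∀ Ψ, IsCong L Ψ → Disjoint Ψ N → Φ ⊆ Ψ → Ψ = Φ := by
  obtain ⟨Φ, -, hΦ⟩ := zorn_subset_nonempty {Φ : Set (A × A) | IsCong L Φ ∧ Disjoint Φ N}
    (fun c hcS hc hne => ⟨⋃₀ c, ⟨IsCong.sUnion (fun θ hθ => (hcS hθ).1) hc hne,
      Set.disjoint_sUnion_left.2 fun θ hθ => (hcS hθ).2⟩, fun θ hθ =>
        Set.subset_sUnion_of_mem hθ⟩) _ ⟨isCong_diagonal A, hN⟩
  exact ⟨Φ, hΦ.prop.1, hΦ.prop.2, fun Ψ h1 h2 h3 =>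
    (hΦ.eq_of_subset ⟨h1, h2⟩ h3).symm⟩

/-- Every congruence is the kernel of a surjective homomorphism. -/
theorem IsCong.exists_quotient [L.IsAlgebraic] {A : Type u} [L.Structure A] {θ : Set (A × A)}
    (h : IsCong L θ) :
    ∃ (M : Struc L) (f : A →[L] M.Carrier), Function.Surjective f ∧ kerSet f = θ := by
  let s : Setoid A := ⟨fun a b => (a, b) ∈ θ, h.refl, h.symm, h.trans⟩
  let _ : L.Structure (Quotient s) :=
    { funMap := fun f x => ⟦Structure.funMap f fun i => (x i).out⟧
      RelMap := fun _ _ => False }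
  refine ⟨⟨Quotient s⟩, homOfMapFun (Quotient.mk s) fun n g x => ?_, Quotient.mk_surjective, ?_⟩
  · exact Quotient.sound (s := s) (h.compat g fun i => h.symm (Quotient.mk_out (s := s) (x i)))
  · ext ⟨a, b⟩
    exact Quotient.eq (r := s)

/-- `θ` is meet-irreducible among all congruences. -/
def MeetIrredCong (L : FirstOrder.Language.{u, u}) {A : Type u} [L.Structure A]
    (θ : Set (A × A)) : Prop :=
  IsCong L θ ∧ ∀ θ₁ θ₂, IsCong L θ₁ → IsCong L θ₂ → θ = θ₁ ∩ θ₂ → θ = θ₁ ∨ θ = θ₂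

theorem MeetIrredCong.of_kerSet {A B : Type u} [L.Structure A] [L.Structure B] {f : A →[L] B}
    (hf : Function.Surjective f) (h : MeetIrredCong L (kerSet f)) :
    MeetIrredCong L (Set.diagonal B) := by
  refine ⟨isCong_diagonal B, fun θ₁ θ₂ h₁ h₂ e => ?_⟩
  have hpull : ∀ θ : Set (B × B), kerSet f = pullback f θ → Set.diagonal B = θ := by
    intro θ hθ
    ext ⟨x, y⟩
    obtain ⟨a, rfl⟩ := hf x
    obtain ⟨b, rfl⟩ := hf y
    exact Set.ext_iff.1 hθ (a, b)
  have e' : kerSet f = pullback f θ₁ ∩ pullback f θ₂ := by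
    ext ⟨a, b⟩
    exact Set.ext_iff.1 e (f a, f b)
  exact (h.2 _ _ (h₁.pullback f) (h₂.pullback f) e').imp (hpull _) (hpull _)

theorem MeetIrredCong.kerSet {A B : Type u} [L.Structure A] [L.Structure B] (f : A →[L] B)
    (hf : Function.Surjective f) (h : MeetIrredCong L (Set.diagonal B)) :
    MeetIrredCong L (kerSet f) := by
  refine ⟨isCong_kerSet f, fun θ₁ θ₂ h₁ h₂ e => ?_⟩
  have k₁ : Transfer.kerSet f ⊆ θ₁ := e ▸ Set.inter_subset_left
  have k₂ : Transfer.kerSet f ⊆ θ₂ := e ▸ Set.inter_subset_right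
  have p₁ := pullback_pushforward h₁ f k₁
  have p₂ := pullback_pushforward h₂ f k₂
  have e' : Set.diagonal B = pushforward f θ₁ ∩ pushforward f θ₂ := by
    ext ⟨x, y⟩
    obtain ⟨a, rfl⟩ := hf x
    obtain ⟨b, rfl⟩ := hf y
    have := Set.ext_iff.1 e (a, b)
    rw [← p₁, ← p₂] at this
    exact this
  have back : ∀ θ, pullback f (pushforward f θ) = θ → Set.diagonal B = pushforward f θ →
      Transfer.kerSet f = θ := by
    intro θ p d
    rw [← p, ← d]
    rfl
  exact (h.2 _ _ (h₁.pushforward f hf k₁) (h₂.pushforward f hf k₂) e').imp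
    (back _ p₁) (back _ p₂)

end Congruences

section Varieties

variable {L : FirstOrder.Language.{u, u}}

theorem isCong_of_mem_ConQ {V : Set (Struc L)} {A : Struc L} {θ : Set (A.Carrier × A.Carrier)}
    (h : θ ∈ ConQ V A) : IsCong L θ := by
  obtain ⟨M, -, f, rfl⟩ := h
  exact isCong_kerSet f

theorem mem_ConQ_iff [L.IsAlgebraic] {V : Set (Struc L)} (hV : IsVariety L V) {A : Struc L}
    (hA : A ∈ V) {θ : Set (A.Carrier × A.Carrier)} : θ ∈ ConQ V A ↔ IsCong L θ := by
  refine ⟨isCong_of_mem_ConQ, fun h => ?_⟩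
  obtain ⟨M, f, hf, hk⟩ := h.exists_quotient
  exact ⟨M, hV.1 A hA M f hf, f, hk.symm⟩

theorem mem_RFSI_iff [L.IsAlgebraic] {V : Set (Struc L)} (hV : IsVariety L V) {A : Struc L} :
    A ∈ RFSI V ↔ A ∈ V ∧ MeetIrredCong L (Set.diagonal A.Carrier) := by
  refine and_congr_right fun hA => ?_
  simp only [MeetIrred, MeetIrredCong, mem_ConQ_iff hV hA]
  exact and_congr_right fun _ =>
    ⟨fun h θ₁ θ₂ h₁ h₂ => h θ₁ h₁ θ₂ h₂, fun h θ₁ h₁ θ₂ h₂ => h θ₁ θ₂ h₁ h₂⟩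

/-- A structure separated by homomorphisms into members of a variety lies in the variety. -/
theorem IsVariety.mem_of_separating [L.IsAlgebraic] {V : Set (Struc L)} (hV : IsVariety L V)
    {ι : Type u} {A : Struc L} (M : ι → Struc L) (hM : ∀ i, M i ∈ V)
    (f : ∀ i, A.Carrier →[L] (M i).Carrier) (hf : ∀ a b, (∀ i, f i a = f i b) → a = b) :
    A ∈ V := by
  let g := piHom (fun i => (M i).Carrier) f
  have hg : ∀ a b, g a = g b → a = b := fun a b h => hf a b fun i => congrFun h i
  have hR := hV.2.1 _ (hV.2.2 ι M hM) g.range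
  obtain ⟨h, hh⟩ := exists_factor (rangeMap g) (Hom.id L A.Carrier) (rangeMap_surjective g)
    fun a b hab => hg a b ((rangeMap_eq_iff g a b).1 hab)
  exact hV.1 _ hR A h fun a => ⟨rangeMap g a, hh a⟩

theorem IsVariety.mem_of_injective [L.IsAlgebraic] {V : Set (Struc L)} (hV : IsVariety L V)
    {A M : Struc L} (hM : M ∈ V) (f : A.Carrier →[L] M.Carrier) (hf : Function.Injective f) :
    A ∈ V :=
  hV.mem_of_separating (ι := PUnit) (fun _ => M) (fun _ => hM) (fun _ => f)
    fun _ _ h => hf (h ⟨⟩)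

theorem isVariety_varJoin (V₁ V₂ : Set (Struc L)) : IsVariety L (varJoin L V₁ V₂) :=
  ⟨fun A hA B f hf W hW => hW.1.1 A (hA W hW) B f hf,
    fun B hB S W hW => hW.1.2.1 B (hB W hW) S,
    fun ι f hf W hW => hW.1.2.2 ι f fun i => hf i W hW⟩

theorem left_subset_varJoin (V₁ V₂ : Set (Struc L)) : V₁ ⊆ varJoin L V₁ V₂ :=
  fun _ hA _ hW => hW.2.1 hA

theorem right_subset_varJoin (V₁ V₂ : Set (Struc L)) : V₂ ⊆ varJoin L V₁ V₂ :=
  fun _ hA _ hW => hW.2.2 hA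

/-- The quotients of structures embeddable in a product of a member of `V₁` and one of `V₂`. -/
def quotientsOfSubproducts (V₁ V₂ : Set (Struc L)) : Set (Struc L) :=
  {A | ∃ B M₁ M₂ : Struc L, M₁ ∈ V₁ ∧ M₂ ∈ V₂ ∧
    ∃ (f : B.Carrier →[L] A.Carrier) (g₁ : B.Carrier →[L] M₁.Carrier)
      (g₂ : B.Carrier →[L] M₂.Carrier), Function.Surjective f ∧
        ∀ a b, g₁ a = g₁ b → g₂ a = g₂ b → a = b}

theorem isVariety_quotientsOfSubproducts {V₁ V₂ : Set (Struc L)} (hV₁ : IsVariety L V₁)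
    (hV₂ : IsVariety L V₂) : IsVariety L (quotientsOfSubproducts V₁ V₂) := by
  refine ⟨?_, ?_, ?_⟩
  · rintro A ⟨B, M₁, M₂, h₁, h₂, f, g₁, g₂, hf, hg⟩ C k hk
    exact ⟨B, M₁, M₂, h₁, h₂, k.comp f, g₁, g₂, hk.comp hf, hg⟩
  · rintro A ⟨B, M₁, M₂, h₁, h₂, f, g₁, g₂, hf, hg⟩ S
    let T := S.comap f
    refine ⟨ofSub B T, M₁, M₂, h₁, h₂, (f.domRestrict T).codRestrict S fun c => c.2,
      g₁.domRestrict T, g₂.domRestrict T, ?_, ?_⟩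
    · rintro ⟨a, ha⟩
      obtain ⟨b, rfl⟩ := hf a
      exact ⟨⟨b, ha⟩, rfl⟩
    · intro a b e₁ e₂
      exact Subtype.ext (hg a b e₁ e₂)
  · intro ι A hA
    choose B M₁ M₂ h₁ h₂ f g₁ g₂ hf hg using hA
    refine ⟨⟨∀ i, (B i).Carrier⟩, ⟨∀ i, (M₁ i).Carrier⟩, ⟨∀ i, (M₂ i).Carrier⟩,
      hV₁.2.2 ι M₁ h₁, hV₂.2.2 ι M₂ h₂,
      piHom _ fun i => (f i).comp (projHom _ i), piHom _ fun i => (g₁ i).comp (projHom _ i),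
      piHom _ fun i => (g₂ i).comp (projHom _ i), ?_, ?_⟩
    · intro a
      choose b hb using fun i => hf i (a i)
      exact ⟨b, funext hb⟩
    · intro a b e₁ e₂
      exact funext fun i => hg i _ _ (congrFun e₁ i) (congrFun e₂ i)

theorem IsVariety.exists_hom_subsingleton [L.IsAlgebraic] {V : Set (Struc L)}
    (hV : IsVariety L V) (A : Struc L) : ∃ M ∈ V, Nonempty (A.Carrier →[L] M.Carrier) :=
  ⟨_, hV.2.2 PEmpty (fun i => i.elim) fun i => i.elim, ⟨piHom _ fun i => i.elim⟩⟩

theorem varJoin_subset_quotientsOfSubproducts [L.IsAlgebraic] {V₁ V₂ : Set (Struc L)}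
    (hV₁ : IsVariety L V₁) (hV₂ : IsVariety L V₂) :
    varJoin L V₁ V₂ ⊆ quotientsOfSubproducts V₁ V₂ := by
  refine Set.sInter_subset_of_mem ⟨isVariety_quotientsOfSubproducts hV₁ hV₂, ?_, ?_⟩
  · intro A hA
    obtain ⟨M, hM, ⟨g⟩⟩ := hV₂.exists_hom_subsingleton A
    exact ⟨A, A, M, hA, hM, Hom.id L _, Hom.id L _, g, Function.surjective_id,
      fun _ _ e _ => e⟩
  · intro A hA
    obtain ⟨M, hM, ⟨g⟩⟩ := hV₁.exists_hom_subsingleton A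
    exact ⟨A, M, A, hM, hA, Hom.id L _, g, Hom.id L _, Function.surjective_id,
      fun _ _ _ e => e⟩

theorem joinQ_subset [L.IsAlgebraic] {V : Set (Struc L)} (hV : IsVariety L V) {A : Struc L}
    (hA : A ∈ V) {θ φ χ : Set (A.Carrier × A.Carrier)} (hχ : IsCong L χ) (h₁ : θ ⊆ χ)
    (h₂ : φ ⊆ χ) : joinQ V A θ φ ⊆ χ :=
  Set.sInter_subset_of_mem ⟨(mem_ConQ_iff hV hA).2 hχ, Set.union_subset h₁ h₂⟩

theorem subset_joinQ (V : Set (Struc L)) (A : Struc L) (θ φ : Set (A.Carrier × A.Carrier)) :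
    θ ∪ φ ⊆ joinQ V A θ φ :=
  Set.subset_sInter fun _ h => h.2

/-- In a congruence-distributive variety, meet-irreducible congruences are meet-prime. -/
theorem MeetIrredCong.prime [L.IsAlgebraic] {V : Set (Struc L)} (hV : IsVariety L V)
    (hd : RelCongDist V) {A : Struc L} (hA : A ∈ V) {θ α β : Set (A.Carrier × A.Carrier)}
    (hθ : MeetIrredCong L θ) (hα : IsCong L α) (hβ : IsCong L β) (h : α ∩ β ⊆ θ) :
    α ⊆ θ ∨ β ⊆ θ := by
  have hJ : ∀ φ ψ, IsCong L (joinQ V A φ ψ) := fun φ ψ =>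
    IsCong.sInter fun χ hχ => isCong_of_mem_ConQ hχ.1
  have dist : ∀ {χ φ ψ : Set (A.Carrier × A.Carrier)}, IsCong L χ → IsCong L φ → IsCong L ψ →
      χ ∩ joinQ V A φ ψ = joinQ V A (χ ∩ φ) (χ ∩ ψ) := fun h₁ h₂ h₃ =>
    hd A hA _ ((mem_ConQ_iff hV hA).2 h₁) _ ((mem_ConQ_iff hV hA).2 h₂) _
      ((mem_ConQ_iff hV hA).2 h₃)
  have hle : ∀ φ, θ ⊆ joinQ V A θ φ := fun φ => Set.subset_union_left.trans (subset_joinQ V A θ φ)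
  have hinner : β ∩ joinQ V A θ α ⊆ θ := by
    rw [dist hβ hθ.1 hα]
    exact joinQ_subset hV hA hθ.1 Set.inter_subset_right (by rwa [Set.inter_comm])
  have key : joinQ V A θ α ∩ joinQ V A θ β ⊆ θ := by
    rw [dist (hJ θ α) hθ.1 hβ]
    exact joinQ_subset hV hA hθ.1 Set.inter_subset_right (by rwa [Set.inter_comm])
  refine (hθ.2 _ _ (hJ θ α) (hJ θ β)
    ((Set.subset_inter (hle α) (hle β)).antisymm key)).imp (fun e => ?_) fun e => ?_
  · exact (Set.subset_union_right.trans (subset_joinQ V A θ α)).trans e.symm.subset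
  · exact (Set.subset_union_right.trans (subset_joinQ V A θ β)).trans e.symm.subset

/-- Distinct elements are separated by a finitely subdirectly irreducible quotient. -/
theorem exists_fsi_quotient_separating [L.IsAlgebraic] {B : Struc L} {b b' : B.Carrier}
    (hb : b ≠ b') :
    ∃ (M : Struc L) (f : B.Carrier →[L] M.Carrier), Function.Surjective f ∧ f b ≠ f b' ∧
      MeetIrredCong L (Set.diagonal M.Carrier) := by
  obtain ⟨Φ, hΦ, hN, hmax⟩ := exists_maximal_cong (L := L) (N := {(b, b')})
    (Set.disjoint_singleton_right.2 hb)
  have hΦi : MeetIrredCong L Φ := by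
    refine ⟨hΦ, fun θ₁ θ₂ h₁ h₂ e => ?_⟩
    rw [Set.disjoint_singleton_right, e, Set.mem_inter_iff, not_and_or] at hN
    refine hN.imp (fun h => ?_) fun h => ?_
    · exact (hmax θ₁ h₁ (Set.disjoint_singleton_right.2 h) (e ▸ Set.inter_subset_left)).symm
    · exact (hmax θ₂ h₂ (Set.disjoint_singleton_right.2 h) (e ▸ Set.inter_subset_right)).symm
  obtain ⟨M, f, hf, rfl⟩ := hΦ.exists_quotient
  exact ⟨M, f, hf, fun e => Set.disjoint_singleton_right.1 hN e, hΦi.of_kerSet hf⟩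

/-- The congruence extension property along a homomorphism `g : A → N`:
a congruence of `A` above the kernel of `g` is pulled back from a congruence of `N`. -/
theorem HasQCEP.exists_pullback [L.IsAlgebraic] {V : Set (Struc L)} (hV : IsVariety L V)
    {A N : Struc L} (hN : N ∈ V) (hcep : HasQCEP V N) (g : A.Carrier →[L] N.Carrier)
    {θ : Set (A.Carrier × A.Carrier)} (hθ : IsCong L θ) (hk : kerSet g ⊆ θ) :
    ∃ Φ, IsCong L Φ ∧ pullback g Φ = θ := by
  have hk' : kerSet (rangeMap g) ⊆ θ := (kerSet_rangeMap g).trans_subset hk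
  obtain ⟨Φ, hΦ, e⟩ := hcep g.range (pushforward (rangeMap g) θ)
    ((mem_ConQ_iff hV (hV.2.1 N hN g.range)).2
      (hθ.pushforward (rangeMap g) (rangeMap_surjective g) hk'))
  refine ⟨Φ, isCong_of_mem_ConQ hΦ, ?_⟩
  rw [← pullback_pushforward hθ (rangeMap g) hk', ← e]
  rfl

/-- In a congruence-distributive variety whose finitely subdirectly irreducible members have the
congruence extension property, meet-irreducible congruences extend to meet-irreducible ones. -/
theorem exists_fsi_quotient_extending [L.IsAlgebraic] {V : Set (Struc L)} (hV : IsVariety L V)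
    (hd : RelCongDist V)
    (hcep : ∀ N ∈ V, MeetIrredCong L (Set.diagonal N.Carrier) → HasQCEP V N)
    {A C : Struc L} (hA : A ∈ V) (hC : C ∈ V) (φ : A.Carrier →[L] C.Carrier)
    (hφ : Function.Injective φ) {θ : Set (A.Carrier × A.Carrier)} (hθ : MeetIrredCong L θ) :
    ∃ (N : Struc L) (g : C.Carrier →[L] N.Carrier), Function.Surjective g ∧
      MeetIrredCong L (Set.diagonal N.Carrier) ∧ kerSet (g.comp φ) = θ := by
  have hdisj : ∀ Ψ : Set (C.Carrier × C.Carrier),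
      Disjoint Ψ (pushforward φ θᶜ) ↔ pullback φ Ψ ⊆ θ := by
    intro Ψ
    rw [Set.disjoint_left]
    constructor
    · rintro h ⟨a, b⟩ hab
      by_contra hn
      exact h hab ⟨a, b, hn, rfl, rfl⟩
    · rintro h ⟨_, _⟩ hΨ ⟨a, b, hn, rfl, rfl⟩
      exact hn (h hΨ)
  obtain ⟨Ψ, hΨ, hN, hmax⟩ := exists_maximal_cong (L := L) (N := pushforward φ θᶜ)
    ((hdisj _).2 fun p hp => hθ.1.diagonal_subset (hφ hp))
  simp only [hdisj] at hN hmax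
  have hΨi : MeetIrredCong L Ψ := by
    refine ⟨hΨ, fun Ψ₁ Ψ₂ h₁ h₂ e => ?_⟩
    refine (hθ.prime hV hd hA (h₁.pullback φ) (h₂.pullback φ) ?_).imp (fun h => ?_) fun h => ?_
    · rw [e] at hN
      exact hN
    · exact (hmax Ψ₁ h₁ h (e ▸ Set.inter_subset_left)).symm
    · exact (hmax Ψ₂ h₂ h (e ▸ Set.inter_subset_right)).symm
  obtain ⟨N, g, hg, rfl⟩ := hΨ.exists_quotient
  have hNi := hΨi.of_kerSet hg
  have hNV := hV.1 C hC N g hg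
  obtain ⟨Φ, hΦ, e⟩ := (hcep N hNV hNi).exists_pullback hV hNV (g.comp φ) hθ.1 hN
  refine ⟨N, g, hg, hNi, ?_⟩
  have hΦg : pullback g Φ = kerSet g := by
    refine hmax _ (hΦ.pullback g) e.subset ?_
    rintro ⟨a, b⟩ (hab : g a = g b)
    change (g a, g b) ∈ Φ
    rw [hab]
    exact hΦ.refl _
  rw [← e]
  exact congrArg (pullback φ) hΦg.symm

/-- In a congruence-distributive join of two varieties, finitely subdirectly irreducible members
belong to one of the two varieties. -/
theorem mem_or_mem_of_fsi [L.IsAlgebraic] {V₁ V₂ : Set (Struc L)} (hV₁ : IsVariety L V₁)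
    (hV₂ : IsVariety L V₂) (hd : RelCongDist (varJoin L V₁ V₂)) {M : Struc L}
    (hM : M ∈ varJoin L V₁ V₂) (hMi : MeetIrredCong L (Set.diagonal M.Carrier)) :
    M ∈ V₁ ∨ M ∈ V₂ := by
  obtain ⟨B, M₁, M₂, h₁, h₂, f, g₁, g₂, hf, hg⟩ :=
    varJoin_subset_quotientsOfSubproducts hV₁ hV₂ hM
  have hV := isVariety_varJoin V₁ V₂
  have hB : B ∈ varJoin L V₁ V₂ :=
    hV.mem_of_separating (ι := ULift Bool) (fun i => bif i.down then M₁ else M₂)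
      (by rintro ⟨_ | _⟩; exacts [right_subset_varJoin _ _ h₂, left_subset_varJoin _ _ h₁])
      (fun i => match i with
        | ⟨true⟩ => g₁
        | ⟨false⟩ => g₂)
      fun a b h => hg a b (h ⟨true⟩) (h ⟨false⟩)
  have hmem : ∀ (V : Set (Struc L)) (M' : Struc L) (g : B.Carrier →[L] M'.Carrier),
      IsVariety L V → M' ∈ V → kerSet g ⊆ kerSet f → M ∈ V := by
    intro V M' g hV' hM' hk
    obtain ⟨h, hh⟩ := exists_factor (rangeMap g) f (rangeMap_surjective g) fun a b hab =>
      hk (show (a, b) ∈ kerSet g from (rangeMap_eq_iff g a b).1 hab)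
    refine hV'.1 _ (hV'.2.1 M' hM' g.range) M h fun m => ?_
    obtain ⟨b, rfl⟩ := hf m
    exact ⟨_, hh b⟩
  refine ((MeetIrredCong.kerSet f hf hMi).prime hV hd hB (isCong_kerSet g₁) (isCong_kerSet g₂)
    ?_).imp (hmem V₁ M₁ g₁ hV₁ h₁) (hmem V₂ M₂ g₂ hV₂ h₂)
  rintro ⟨a, b⟩ ⟨e₁, e₂⟩
  exact congrArg f (hg a b e₁ e₂)

/-- The congruence extension property of a structure transfers to a larger class. -/
theorem HasQCEP.mono [L.IsAlgebraic] {V W : Set (Struc L)} (hV : IsVariety L V) (hVW : V ⊆ W)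
    {N : Struc L} (hN : N ∈ V) (h : HasQCEP V N) : HasQCEP W N := by
  intro S θ hθ
  obtain ⟨Φ, ⟨M, hM, f, hf⟩, e⟩ :=
    h S θ ((mem_ConQ_iff hV (hV.2.1 N hN S)).2 (isCong_of_mem_ConQ hθ))
  exact ⟨Φ, ⟨M, hVW hM, f, hf⟩, e⟩

/-- An injective homomorphism whose range is a retract has a left inverse. -/
theorem exists_leftInverse [L.IsAlgebraic] {A N : Struc L} (h : A.Carrier →[L] N.Carrier)
    (hh : Function.Injective h) (hr : IsRetract N h.range) :
    ∃ k : N.Carrier →[L] A.Carrier, ∀ a, k (h a) = a := by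
  obtain ⟨ψ, hψ⟩ := hr
  obtain ⟨j, hj⟩ := exists_factor (rangeMap h) (Hom.id L A.Carrier) (rangeMap_surjective h)
    fun a b hab => hh ((rangeMap_eq_iff h a b).1 hab)
  refine ⟨j.comp ψ, fun a => ?_⟩
  have : ψ (h a) = rangeMap h a := hψ (rangeMap h a)
  exact (congrArg j this).trans (hj a)

/-- Completions of spans separating each pair of distinct elements yield amalgams. -/
theorem IsVariety.hasAP_of_separating {V : Set (Struc L)} (hV : IsVariety L V)
    (H : ∀ A ∈ V, ∀ B ∈ V, ∀ C ∈ V,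
      ∀ (φB : A.Carrier →[L] B.Carrier) (φC : A.Carrier →[L] C.Carrier),
        Function.Injective φB → Function.Injective φC → ∀ b b' : B.Carrier, b ≠ b' →
        ∃ D ∈ V, ∃ (ψB : B.Carrier →[L] D.Carrier) (ψC : C.Carrier →[L] D.Carrier),
          ψB b ≠ ψB b' ∧ ∀ a, ψB (φB a) = ψC (φC a)) :
    HasAP V := by
  intro A hA B hB C hC φB φC hφB hφC
  have HB := fun p : {p : B.Carrier × B.Carrier // p.1 ≠ p.2} =>
    H A hA B hB C hC φB φC hφB hφC p.1.1 p.1.2 p.2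
  have HC := fun p : {p : C.Carrier × C.Carrier // p.1 ≠ p.2} =>
    H A hA C hC B hB φC φB hφC hφB p.1.1 p.1.2 p.2
  choose D hD fB fC hsep hcomm using HB
  choose E hE gC gB hsep' hcomm' using HC
  refine ⟨⟨∀ i, (Sum.elim D E i).Carrier⟩, hV.2.2 _ (Sum.elim D E) (Sum.rec hD hE),
    piHom (fun i => (Sum.elim D E i).Carrier) (Sum.rec fB gB),
    piHom (fun i => (Sum.elim D E i).Carrier) (Sum.rec fC gC), ?_, ?_, ?_⟩
  · intro b b' h
    by_contra hne
    exact hsep ⟨(b, b'), hne⟩ (congrFun h (Sum.inl ⟨(b, b'), hne⟩))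
  · intro c c' h
    by_contra hne
    exact hsep' ⟨(c, c'), hne⟩ (congrFun h (Sum.inr ⟨(c, c'), hne⟩))
  · intro a
    funext i
    rcases i with p | p
    · exact hcomm p a
    · exact (hcomm' p a).symm

end Varieties

/-- Proposition 3.5: joins of two varieties with the AP and CEP, whose FSI
classes are closed under substructures and satisfy the retract condition, have the AP. -/
theorem stmt14 (L : FirstOrder.Language.{u, u}) [L.IsAlgebraic]
    (V₁ V₂ : Set (Struc L)) (hV₁ : IsVariety L V₁) (hV₂ : IsVariety L V₂)
    (hd : RelCongDist (varJoin L V₁ V₂))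
    (hap₁ : HasAP V₁) (hap₂ : HasAP V₂)
    (hcep₁ : ClassQCEP V₁ V₁) (hcep₂ : ClassQCEP V₂ V₂)
    (hs₁ : SubClosed (RFSI V₁)) (hs₂ : SubClosed (RFSI V₂))
    (hret : ∀ B ∈ RFSI V₁ ∪ RFSI V₂, ∀ S : L.Substructure B.Carrier,
      ofSub B S ∈ RFSI V₁ ∩ RFSI V₂ → IsRetract B S) :
    HasAP (varJoin L V₁ V₂) := by
  have hV := isVariety_varJoin V₁ V₂
  have hl := left_subset_varJoin V₁ V₂
  have hr := right_subset_varJoin V₁ V₂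
  have hcep : ∀ N ∈ varJoin L V₁ V₂, MeetIrredCong L (Set.diagonal N.Carrier) →
      HasQCEP (varJoin L V₁ V₂) N := by
    intro N hN hNi
    rcases mem_or_mem_of_fsi hV₁ hV₂ hd hN hNi with h | h
    · exact (hcep₁ N h).mono hV₁ hl h
    · exact (hcep₂ N h).mono hV₂ hr h
  have leftInv : ∀ A ∈ RFSI V₁ ∩ RFSI V₂, ∀ N ∈ RFSI V₁ ∪ RFSI V₂,
      ∀ h : A.Carrier →[L] N.Carrier, Function.Injective h →
        ∃ k : N.Carrier →[L] A.Carrier, ∀ a, k (h a) = a := by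
    intro A hA N hN h hh
    obtain ⟨hA₁, hAi⟩ := (mem_RFSI_iff hV₁).1 hA.1
    have hA₂ := ((mem_RFSI_iff hV₂).1 hA.2).1
    have hsurj := rangeMap_surjective h
    have hRi : MeetIrredCong L (Set.diagonal h.range) := by
      refine MeetIrredCong.of_kerSet hsurj ?_
      rw [kerSet_rangeMap]
      convert hAi
      exact Set.ext fun p => hh.eq_iff
    exact exists_leftInverse h hh (hret N hN h.range
      ⟨(mem_RFSI_iff hV₁).2 ⟨hV₁.1 A hA₁ (ofSub N h.range) (rangeMap h) hsurj, hRi⟩,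
        (mem_RFSI_iff hV₂).2 ⟨hV₂.1 A hA₂ (ofSub N h.range) (rangeMap h) hsurj, hRi⟩⟩)
  refine hV.hasAP_of_separating fun A hA B hB C hC φB φC hφB hφC b b' hb => ?_
  obtain ⟨M, f, hf, hfb, hMi⟩ := exists_fsi_quotient_separating hb
  have hM := hV.1 B hB M f hf
  let A' := ofSub M (f.comp φB).range
  let q : A.Carrier →[L] A'.Carrier := rangeMap (f.comp φB)
  have hq : Function.Surjective q := rangeMap_surjective _
  have hM' := mem_or_mem_of_fsi hV₁ hV₂ hd hM hMi
  have hsub₁ : M ∈ V₁ → A' ∈ RFSI V₁ := fun h => hs₁ M ((mem_RFSI_iff hV₁).2 ⟨h, hMi⟩) _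
  have hsub₂ : M ∈ V₂ → A' ∈ RFSI V₂ := fun h => hs₂ M ((mem_RFSI_iff hV₂).2 ⟨h, hMi⟩) _
  have hA'i : MeetIrredCong L (Set.diagonal A'.Carrier) :=
    hM'.elim (fun h => ((mem_RFSI_iff hV₁).1 (hsub₁ h)).2)
      fun h => ((mem_RFSI_iff hV₂).1 (hsub₂ h)).2
  obtain ⟨N, g, hg, hNi, hker⟩ := exists_fsi_quotient_extending hV hd hcep hA hC φC hφC
    (MeetIrredCong.kerSet q hq hA'i)
  have hN := hV.1 C hC N g hg
  have hqg : ∀ a a', q a = q a' ↔ g (φC a) = g (φC a') := fun a a' =>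
    (Set.ext_iff.1 hker (a, a')).symm
  obtain ⟨h, hh⟩ := exists_factor q (g.comp φC) hq fun a a' => (hqg a a').1
  have hinj : Function.Injective h := by
    intro x y hxy
    obtain ⟨a, rfl⟩ := hq x
    obtain ⟨a', rfl⟩ := hq y
    rw [hh, hh] at hxy
    exact (hqg a a').2 hxy
  let i : A'.Carrier →[L] M.Carrier := (Substructure.subtype _).toHom
  have hi : Function.Injective i := Subtype.val_injective
  have same : ∀ W : Set (Struc L), IsVariety L W → W ⊆ varJoin L V₁ V₂ → HasAP W → M ∈ W →
      N ∈ W → ∃ D ∈ varJoin L V₁ V₂, ∃ (ψB : B.Carrier →[L] D.Carrier)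
        (ψC : C.Carrier →[L] D.Carrier), ψB b ≠ ψB b' ∧ ∀ a, ψB (φB a) = ψC (φC a) := by
    intro W hW hWV hap hMW hNW
    obtain ⟨D, hD, ψM, ψN, hψM, -, hcomm⟩ :=
      hap A' (hW.2.1 M hMW _) M hMW N hNW i h hi hinj
    exact ⟨D, hWV hD, ψM.comp f, ψN.comp g, fun e => hfb (hψM e), fun a =>
      (hcomm (q a)).trans (congrArg ψN (hh a))⟩
  have diff : A' ∈ RFSI V₁ ∩ RFSI V₂ → N ∈ RFSI V₁ ∪ RFSI V₂ →
      ∃ D ∈ varJoin L V₁ V₂, ∃ (ψB : B.Carrier →[L] D.Carrier)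
        (ψC : C.Carrier →[L] D.Carrier), ψB b ≠ ψB b' ∧ ∀ a, ψB (φB a) = ψC (φC a) := by
    intro hA' hN'
    obtain ⟨k, hk⟩ := leftInv A' hA' N hN' h hinj
    refine ⟨M, hM, f, (i.comp k).comp g, hfb, fun a => ?_⟩
    have : k (g (φC a)) = q a := (congrArg k (hh a)).symm.trans (hk (q a))
    exact (congrArg i this).symm
  rcases hM' with hM₁ | hM₂ <;> rcases mem_or_mem_of_fsi hV₁ hV₂ hd hN hNi with hN₁ | hN₂
  · exact same V₁ hV₁ hl hap₁ hM₁ hN₁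
  · exact diff ⟨hsub₁ hM₁, (mem_RFSI_iff hV₂).2 ⟨hV₂.mem_of_injective hN₂ h hinj, hA'i⟩⟩
      (Or.inr ((mem_RFSI_iff hV₂).2 ⟨hN₂, hNi⟩))
  · exact diff ⟨(mem_RFSI_iff hV₁).2 ⟨hV₁.mem_of_injective hN₁ h hinj, hA'i⟩, hsub₂ hM₂⟩
      (Or.inl ((mem_RFSI_iff hV₁).2 ⟨hN₁, hNi⟩))
  · exact same V₂ hV₂ hr hap₂ hM₂ hN₂

end Transfer
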